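/- arXiv:1207.5229 — 3 statements merged into one kernel-verified Lean document; each statement's English description precedes it below -/
import Mathlib

section
/- Let φ : ℤ[x₁,x₂,x₃,y₁,y₂,y₃,z] → ∏_{w ∈ V} R be the ring homomorphism determined by φ(xᵢ) = τᵢ, φ(yᵢ) = tᵢ and φ(z) = f. Let I be the ideal of ℤ[x₁,x₂,x₃,y₁,y₂,y₃,z] generated by the four polynomials x₁+x₂+x₃, (x₁x₂+x₁x₃+x₂x₃) − (s₁s₂+s₁s₃+s₂s₃), 2z − x₁x₂x₃ − s₁s₂s₃, and z² − z·s₁s₂s₃, where s₁ = y₁−y₂, s₂ = y₂−y₃, s₃ = y₃−y₁. Then the image of φ equals H*_T(𝒢₂) and the kernel of φ equals I; consequently φ induces a ring isomorphism ℤ[x₁,x₂,x₃,y₁,y₂,y₃,z]/I ≅ H*_T(𝒢₂). -/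
open MvPolynomial Equiv

abbrev R3 := MvPolynomial (Fin 3) ℤ

noncomputable def sv (i : Fin 3) : R3 := X i - X (i + 1)

abbrev V2 := Perm (Fin 3) × Bool

/-- The GKM condition for the labeled graph `𝒢₂` of the flag manifold of type `G₂`:
`true` plays the role of `+` and `false` of `−`. -/
def gkm (h : V2 → R3) : Prop :=
  ∀ (v₁ v₂ : Perm (Fin 3)) (ε₁ ε₂ : Bool) (i j : Fin 3), i ≠ j →
    v₁ = v₂ * Equiv.swap i j →
      (ε₁ = ε₂ → sv (v₁ i) - sv (v₁ j) ∣ h (v₁, ε₁) - h (v₂, ε₂)) ∧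
      (ε₁ ≠ ε₂ → ∀ k, k ≠ i → k ≠ j → sv (v₁ k) ∣ h (v₁, ε₁) - h (v₂, ε₂))

noncomputable def tauG (i : Fin 3) : V2 → R3 := fun w => if w.2 then sv (w.1 i) else -sv (w.1 i)
noncomputable def tG (i : Fin 3) : V2 → R3 := fun _ => X i
noncomputable def fG : V2 → R3 := fun w => if w.2 then sv 0 * sv 1 * sv 2 else 0

/-- The graph cohomology ring `H*_T(𝒢₂)`, as a subring of `∏_{w ∈ V} R`. -/
noncomputable def HTG2 : Subring (V2 → R3) where
  carrier := {h | gkm h}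
  zero_mem' := by
    intro v₁ v₂ ε₁ ε₂ i j _ _
    refine ⟨fun _ => ?_, fun _ k _ _ => ?_⟩ <;> simp
  one_mem' := by
    intro v₁ v₂ ε₁ ε₂ i j _ _
    refine ⟨fun _ => ?_, fun _ k _ _ => ?_⟩ <;> simp
  add_mem' := by
    intro a b ha hb v₁ v₂ ε₁ ε₂ i j hij hv
    obtain ⟨ha1, ha2⟩ := ha v₁ v₂ ε₁ ε₂ i j hij hv
    obtain ⟨hb1, hb2⟩ := hb v₁ v₂ ε₁ ε₂ i j hij hv
    have key : (a + b) (v₁, ε₁) - (a + b) (v₂, ε₂)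
        = (a (v₁, ε₁) - a (v₂, ε₂)) + (b (v₁, ε₁) - b (v₂, ε₂)) := by
      simp only [Pi.add_apply]; ring
    refine ⟨fun he => ?_, fun he k hk1 hk2 => ?_⟩
    · rw [key]; exact dvd_add (ha1 he) (hb1 he)
    · rw [key]; exact dvd_add (ha2 he k hk1 hk2) (hb2 he k hk1 hk2)
  neg_mem' := by
    intro a ha v₁ v₂ ε₁ ε₂ i j hij hv
    obtain ⟨ha1, ha2⟩ := ha v₁ v₂ ε₁ ε₂ i j hij hv
    have key : (-a) (v₁, ε₁) - (-a) (v₂, ε₂) = -(a (v₁, ε₁) - a (v₂, ε₂)) := by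
      simp only [Pi.neg_apply]; ring
    refine ⟨fun he => ?_, fun he k hk1 hk2 => ?_⟩
    · rw [key]; exact (dvd_neg).mpr (ha1 he)
    · rw [key]; exact (dvd_neg).mpr (ha2 he k hk1 hk2)
  mul_mem' := by
    intro a b ha hb v₁ v₂ ε₁ ε₂ i j hij hv
    obtain ⟨ha1, ha2⟩ := ha v₁ v₂ ε₁ ε₂ i j hij hv
    obtain ⟨hb1, hb2⟩ := hb v₁ v₂ ε₁ ε₂ i j hij hv
    have key : (a * b) (v₁, ε₁) - (a * b) (v₂, ε₂)
        = a (v₁, ε₁) * (b (v₁, ε₁) - b (v₂, ε₂)) + (a (v₁, ε₁) - a (v₂, ε₂)) * b (v₂, ε₂) := by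
      simp only [Pi.mul_apply]; ring
    refine ⟨fun he => ?_, fun he k hk1 hk2 => ?_⟩
    · rw [key]; exact dvd_add ((hb1 he).mul_left _) ((ha1 he).mul_right _)
    · rw [key]; exact dvd_add ((hb2 he k hk1 hk2).mul_left _) ((ha2 he k hk1 hk2).mul_right _)

/-- The ring homomorphism `φ : ℤ[x₁,x₂,x₃,y₁,y₂,y₃,z] → ∏_{w ∈ V} R` with
`φ(xᵢ) = τᵢ`, `φ(yᵢ) = tᵢ`, `φ(z) = f`, where `x₁,x₂,x₃,y₁,y₂,y₃,z` are the
variables `X 0, …, X 6`. -/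
noncomputable def φG2 : MvPolynomial (Fin 7) ℤ →+* (V2 → R3) :=
  eval₂Hom (Int.castRingHom _) ![tauG 0, tauG 1, tauG 2, tG 0, tG 1, tG 2, fG]

/-- `s₁ = y₁ − y₂` in `ℤ[x₁,x₂,x₃,y₁,y₂,y₃,z]`. -/
noncomputable def s1p : MvPolynomial (Fin 7) ℤ := X 3 - X 4
/-- `s₂ = y₂ − y₃`. -/
noncomputable def s2p : MvPolynomial (Fin 7) ℤ := X 4 - X 5
/-- `s₃ = y₃ − y₁`. -/
noncomputable def s3p : MvPolynomial (Fin 7) ℤ := X 5 - X 3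

/-- The ideal `I` generated by the four polynomials. -/
noncomputable def Ig2 : Ideal (MvPolynomial (Fin 7) ℤ) :=
  Ideal.span {X 0 + X 1 + X 2,
    (X 0 * X 1 + X 0 * X 2 + X 1 * X 2) - (s1p * s2p + s1p * s3p + s2p * s3p),
    2 * X 6 - X 0 * X 1 * X 2 - s1p * s2p * s3p,
    X 6 ^ 2 - X 6 * (s1p * s2p * s3p)}

/-! ### Linear forms -/

lemma dvd_sub_subst (l : R3) (σ : R3 →+* R3) (h0 : ∀ i, l ∣ X i - σ (X i)) (p : R3) :
    l ∣ p - σ p := by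
  have h : (Ideal.Quotient.mk (Ideal.span {l})) =
      (Ideal.Quotient.mk (Ideal.span {l})).comp σ := by
    apply MvPolynomial.ringHom_ext
    · intro r
      simp
    · intro i
      simp only [RingHom.comp_apply]
      rw [Ideal.Quotient.eq, Ideal.mem_span_singleton]
      exact h0 i
  have h2 := congrArg (fun f => f p) h
  simp only [RingHom.comp_apply] at h2
  rwa [Ideal.Quotient.eq, Ideal.mem_span_singleton] at h2

lemma prime_of_subst (l : R3) (σ : R3 →+* R3) (h0 : ∀ i, l ∣ X i - σ (X i))
    (hl : σ l = 0) (hl0 : l ≠ 0) : Prime l := by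
  have key : ∀ p, σ p = 0 → l ∣ p := by
    intro p hp
    have := dvd_sub_subst l σ h0 p
    rwa [hp, sub_zero] at this
  refine ⟨hl0, ?_, ?_⟩
  · intro hu
    have := hu.map σ
    rw [hl] at this
    exact not_isUnit_zero this
  · rintro a b ⟨c, hc⟩
    have h1 : σ a * σ b = 0 := by rw [← map_mul, hc, map_mul, hl, zero_mul]
    rcases mul_eq_zero.mp h1 with h | h
    · exact Or.inl (key _ h)
    · exact Or.inr (key _ h)

lemma ne_zero_of_eval (P : Fin 3 → ℤ) (l : R3) (h : eval P l ≠ 0) : l ≠ 0 := by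
  rintro rfl
  simp at h

lemma relPrime_of_eval (P : Fin 3 → ℤ) {l l' : R3} (hp : Prime l) (h0 : eval P l = 0)
    (h1 : eval P l' ≠ 0) : IsRelPrime l l' := by
  rw [hp.irreducible.isRelPrime_iff_not_dvd]
  rintro ⟨c, rfl⟩
  simp [h0] at h1

lemma prime_sv (a : Fin 3) : Prime (sv a) := by
  refine prime_of_subst _ (aeval (fun i => if i = a then X (a + 1) else X i) : R3 →ₐ[ℤ] R3).toRingHom
    ?_ ?_ ?_
  · intro i
    fin_cases a <;> fin_cases i <;> simp [sv]
  · fin_cases a <;> simp [sv]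
  · apply ne_zero_of_eval (fun i => if i = a then 1 else 0)
    fin_cases a <;> simp [sv]

lemma prime_D (a b : Fin 3) (hab : a ≠ b) : Prime (sv a - sv b) := by
  have main : ∀ c : Fin 3, Prime (sv c - sv (c + 1)) := by
    intro a
    refine prime_of_subst _
      (aeval (fun i => if i = a then 2 * X (a + 1) - X (a + 2) else X i) : R3 →ₐ[ℤ] R3).toRingHom
      ?_ ?_ ?_
    · intro i
      fin_cases a <;> fin_cases i <;> simp [sv]
      all_goals
        apply dvd_of_eq
        ring
    · fin_cases a <;> simp [sv] <;> ring
    · apply ne_zero_of_eval (fun i => if i = a then 1 else 0)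
      fin_cases a <;> simp [sv]
  have h : b = a + 1 ∨ a = b + 1 := by revert a b; decide
  rcases h with rfl | rfl
  · exact main a
  · rw [← neg_sub]
    exact (main b).neg

lemma rel_sv_sv (a b : Fin 3) (hab : a ≠ b) : IsRelPrime (sv a) (sv b) := by
  apply relPrime_of_eval (fun i => if i = a + 2 then 1 else 0) (prime_sv a)
  · fin_cases a <;> simp [sv]
  · fin_cases a <;> fin_cases b <;> simp [sv] at hab ⊢

lemma rel_sv_D (a b c : Fin 3) (hbc : b ≠ c) : IsRelPrime (sv a) (sv b - sv c) := by
  apply relPrime_of_eval (fun i => if i = a + 2 then 1 else 0) (prime_sv a)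
  · fin_cases a <;> simp [sv]
  · fin_cases a <;> fin_cases b <;> fin_cases c <;> simp [sv] at hbc ⊢

lemma rel_D_D (a b c d : Fin 3) (hab : a ≠ b) (hcd : c ≠ d)
    (h : (c ≠ a ∧ c ≠ b) ∨ (d ≠ a ∧ d ≠ b)) : IsRelPrime (sv a - sv b) (sv c - sv d) := by
  apply relPrime_of_eval
    (fun i => if i = - a - b then 0 else if i = - a - b + 1 then 2 else 1) (prime_D a b hab)
  · fin_cases a <;> fin_cases b <;> simp [sv] at hab ⊢ <;> decide
  · fin_cases a <;> fin_cases b <;> simp at hab <;> fin_cases c <;> fin_cases d <;>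
      simp [sv] at hcd h ⊢ <;> decide

/-! ### Evaluation of the homomorphism -/

noncomputable def yemb : R3 →+* MvPolynomial (Fin 7) ℤ :=
  (rename ![3, 4, 5] : R3 →ₐ[ℤ] MvPolynomial (Fin 7) ℤ).toRingHom

@[simp] lemma yemb_X0 : yemb (X 0) = X 3 := by simp [yemb]
@[simp] lemma yemb_X1 : yemb (X 1) = X 4 := by simp [yemb]
@[simp] lemma yemb_X2 : yemb (X 2) = X 5 := by simp [yemb]

@[simp] lemma phi_X0 (w : V2) : φG2 (X 0) w = tauG 0 w := by simp [φG2]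
@[simp] lemma phi_X1 (w : V2) : φG2 (X 1) w = tauG 1 w := by simp [φG2]
@[simp] lemma phi_X2 (w : V2) : φG2 (X 2) w = tauG 2 w := by simp [φG2]
@[simp] lemma phi_X3 (w : V2) : φG2 (X 3) w = X 0 := by simp [φG2, tG]
@[simp] lemma phi_X4 (w : V2) : φG2 (X 4) w = X 1 := by simp [φG2, tG]
@[simp] lemma phi_X5 (w : V2) : φG2 (X 5) w = X 2 := by simp [φG2, tG]
@[simp] lemma phi_X6 (w : V2) : φG2 (X 6) w = fG w := by simp [φG2]

@[simp] lemma phi_yemb (p : R3) (w : V2) : φG2 (yemb p) w = p := by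
  have : ((Pi.evalRingHom (fun _ : V2 => R3) w).comp φG2).comp yemb = RingHom.id R3 := by
    apply MvPolynomial.ringHom_ext
    · intro r
      simp
    · intro i
      fin_cases i <;> simp
  exact congrArg (fun f => f p) this

/-! ### The image is contained in the graph cohomology -/

lemma sum_sv : sv 0 + sv 1 + sv 2 = 0 := by
  simp [sv]

lemma sum_sv_perm (v : Perm (Fin 3)) (i j k : Fin 3) (hij : i ≠ j) (hki : k ≠ i) (hkj : k ≠ j) :
    sv (v i) + sv (v j) + sv (v k) = 0 := by
  have h1 : v i ≠ v j := fun h => hij (v.injective h)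
  have h2 : v k ≠ v i := fun h => hki (v.injective h)
  have h3 : v k ≠ v j := fun h => hkj (v.injective h)
  generalize v i = a at *
  generalize v j = b at *
  generalize v k = c at *
  have := sum_sv
  fin_cases a <;> fin_cases b <;> fin_cases c <;> simp at h1 h2 h3 ⊢ <;>
    linear_combination this

lemma sv_dvd_prod (a : Fin 3) : sv a ∣ sv 0 * sv 1 * sv 2 := by
  fin_cases a
  · exact ⟨sv 1 * sv 2, by simp; ring⟩
  · exact ⟨sv 0 * sv 2, by simp; ring⟩
  · exact ⟨sv 0 * sv 1, by simp; ring⟩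

lemma tau_mem (m : Fin 3) : tauG m ∈ HTG2 := by
  intro v₁ v₂ ε₁ ε₂ i j hij hv
  have hv2 : v₂ = v₁ * swap i j := by
    rw [hv, mul_assoc, swap_mul_self, mul_one]
  subst hv2
  refine ⟨fun he => ?_, fun he k hki hkj => ?_⟩
  · subst he
    have hd : sv (v₁ i) - sv (v₁ j) ∣ sv (v₁ m) - sv (v₁ (swap i j m)) := by
      by_cases hmi : m = i
      · subst hmi; simp
      · by_cases hmj : m = j
        · subst hmj
          rw [swap_apply_right, ← neg_sub, neg_dvd]
        · rw [swap_apply_of_ne_of_ne hmi hmj]; simp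
    cases ε₁
    · simp only [tauG, Perm.mul_apply]
      have h := (dvd_neg).mpr hd
      convert h using 1
      simp
      ring
    · simpa [tauG] using hd
  · have hs := sum_sv_perm v₁ i j k hij hki hkj
    have hd : sv (v₁ k) ∣ sv (v₁ m) + sv (v₁ (swap i j m)) := by
      by_cases hmi : m = i
      · subst hmi
        rw [swap_apply_left]
        exact ⟨-1, by linear_combination hs⟩
      · by_cases hmj : m = j
        · subst hmj
          rw [swap_apply_right]
          exact ⟨-1, by linear_combination hs⟩
        · have : m = k := by clear hs hv; revert i j k m; decide
          subst this
          rw [swap_apply_of_ne_of_ne hmi hmj]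
          exact ⟨2, by ring⟩
    cases ε₁ <;> cases ε₂ <;> simp at he
    · have h := (dvd_neg).mpr hd
      convert h using 1
      simp [tauG]
      ring
    · simpa [tauG] using hd

lemma t_mem (m : Fin 3) : tG m ∈ HTG2 := by
  intro v₁ v₂ ε₁ ε₂ i j hij hv
  simp [tG]

lemma f_mem : fG ∈ HTG2 := by
  intro v₁ v₂ ε₁ ε₂ i j hij hv
  refine ⟨fun he => ?_, fun he k hki hkj => ?_⟩
  · subst he; simp [fG]
  · have := sv_dvd_prod (v₁ k)
    cases ε₁ <;> cases ε₂ <;> simp at he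
    · simpa [fG] using this
    · simpa [fG] using this

lemma phi_mem (p : MvPolynomial (Fin 7) ℤ) : φG2 p ∈ HTG2 := by
  induction p using MvPolynomial.induction_on with
  | C a => simp
  | add p q hp hq => rw [map_add]; exact add_mem hp hq
  | mul_X p i hp =>
    rw [map_mul]
    refine mul_mem hp ?_
    have h : φG2 (X i) = ![tauG 0, tauG 1, tauG 2, tG 0, tG 1, tG 2, fG] i := by simp [φG2]
    rw [h]
    fin_cases i
    · exact tau_mem 0
    · exact tau_mem 1
    · exact tau_mem 2
    · exact t_mem 0
    · exact t_mem 1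
    · exact t_mem 2
    · exact f_mem

/-! ### Fibres -/

/-- `h` vanishes on the fibre of vertices `(v, ε)` with `v 0 = a`. -/
def Van (h : V2 → R3) (a : Fin 3) (ε : Bool) : Prop :=
  ∀ v : Perm (Fin 3), v 0 = a → h (v, ε) = 0

lemma edge_same {h : V2 → R3} (hh : h ∈ HTG2) {v : Perm (Fin 3)} {ε : Bool} {b : Fin 3}
    (hb : b ≠ v 0) (hz : Van h b ε) : sv (v 0) - sv b ∣ h (v, ε) := by
  obtain ⟨j, rfl⟩ := v.surjective b
  have hj : (0 : Fin 3) ≠ j := by rintro rfl; exact hb rfl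
  have h1 := (hh v (v * swap 0 j) ε ε 0 j hj (by rw [mul_assoc, swap_mul_self, mul_one])).1 rfl
  rwa [hz (v * swap 0 j) (by simp), sub_zero] at h1

lemma edge_same' {h : V2 → R3} (hh : h ∈ HTG2) {v : Perm (Fin 3)} {ε : Bool} {b : Fin 3}
    (hb : b ≠ v 0) (hz : Van h b ε) : sv b - sv (v 0) ∣ h (v, ε) := by
  rw [← neg_sub, neg_dvd]
  exact edge_same hh hb hz

lemma edge_opp {h : V2 → R3} (hh : h ∈ HTG2) (v : Perm (Fin 3))
    (hz : ∀ a, Van h a true) (c : Fin 3) : sv c ∣ h (v, false) := by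
  obtain ⟨k, rfl⟩ := v.surjective c
  obtain ⟨i, j, hij, hki, hkj⟩ : ∃ i j : Fin 3, i ≠ j ∧ k ≠ i ∧ k ≠ j := by
    revert k; decide
  have h1 := (hh v (v * swap i j) false true i j hij
    (by rw [mul_assoc, swap_mul_self, mul_one])).2 (by simp) k hki hkj
  rwa [hz _ (v * swap i j) rfl, sub_zero] at h1

lemma fibre_cases (v u : Perm (Fin 3)) (h : v 0 = u 0) : v = u ∨ v = u * swap 1 2 := by
  revert v u; decide

lemma step {h : V2 → R3} (hh : h ∈ HTG2) (g : MvPolynomial (Fin 7) ℤ) (a : Fin 3) (ε : Bool)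
    (L : R3) (hg : ∀ v : Perm (Fin 3), v 0 = a → φG2 g (v, ε) = L)
    (hL : ∀ v : Perm (Fin 3), v 0 = a → L ∣ h (v, ε))
    (hrel : ∀ b c : Fin 3, b ≠ c → b ≠ a → c ≠ a → IsRelPrime (sv b - sv c) L)
    : ∃ P, Van (h - φG2 (g * P)) a ε := by
  obtain ⟨v, hv⟩ : ∃ v : Perm (Fin 3), v 0 = a := ⟨swap 0 a, by simp⟩
  have hv' : (v * swap 1 2 : Perm (Fin 3)) 0 = a := by
    rw [Perm.mul_apply, swap_apply_of_ne_of_ne (by decide) (by decide), hv]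
  obtain ⟨α, hα⟩ := hL v hv
  obtain ⟨β, hβ⟩ := hL _ hv'
  have h1 := (hh v (v * swap 1 2) ε ε 1 2 (by decide)
    (by rw [mul_assoc, swap_mul_self, mul_one])).1 rfl
  rw [hα, hβ, ← mul_sub] at h1
  have hr := hrel (v 1) (v 2) (by simp) (by rw [← hv]; simp) (by rw [← hv]; simp)
  obtain ⟨q, hq⟩ := hr.dvd_of_dvd_mul_left h1
  obtain ⟨e, he, het⟩ : ∃ e : R3, e * e = 1 ∧ ∀ u : Perm (Fin 3), tauG 1 (u, ε) = e * sv (u 1) := by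
    cases ε
    · exact ⟨-1, by ring, fun u => by simp [tauG]⟩
    · exact ⟨1, by ring, fun u => by simp [tauG]⟩
  have hval : ∀ u : Perm (Fin 3), u 0 = a →
      (h - φG2 (g * (yemb (α - q * sv (v 1)) + yemb (e * q) * X 1))) (u, ε) =
        h (u, ε) - L * (α - q * sv (v 1) + q * sv (u 1)) := by
    intro u hu
    rw [Pi.sub_apply, map_mul, Pi.mul_apply, hg u hu, map_add, Pi.add_apply, map_mul φG2,
      Pi.mul_apply, phi_yemb, phi_yemb, phi_X1, het]
    linear_combination - L * q * sv (u 1) * he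
  refine ⟨yemb (α - q * sv (v 1)) + yemb (e * q) * X 1, ?_⟩
  intro u hu
  rw [hval u hu]
  rcases fibre_cases u v (hu.trans hv.symm) with rfl | rfl
  · rw [hα]; ring
  · have : (v * swap 1 2 : Perm (Fin 3)) 1 = v 2 := by simp
    rw [hβ, this]
    linear_combination - L * hq

lemma van_sub {h : V2 → R3} {g : MvPolynomial (Fin 7) ℤ} (P : MvPolynomial (Fin 7) ℤ)
    {a : Fin 3} {ε : Bool} (h1 : Van h a ε) (h2 : Van (φG2 g) a ε) :
    Van (h - φG2 (g * P)) a ε := by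
  intro v hv
  simp [h1 v hv, h2 v hv]

/-! ### Surjectivity -/

noncomputable def ss (i : Fin 3) : MvPolynomial (Fin 7) ℤ := yemb (sv i)

@[simp] lemma phi_ss (i : Fin 3) (w : V2) : φG2 (ss i) w = sv i := phi_yemb _ _

noncomputable def sig : R3 := sv 0 * sv 1 * sv 2

lemma rel_D_sig (b c : Fin 3) (hbc : b ≠ c) : IsRelPrime (sv b - sv c) sig :=
  ((((rel_sv_D 0 b c hbc).mul_left (rel_sv_D 1 b c hbc)).mul_left (rel_sv_D 2 b c hbc))).symm

lemma sig_dvd {x : R3} (h : ∀ c, sv c ∣ x) : sig ∣ x := by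
  refine IsRelPrime.mul_dvd ?_ (IsRelPrime.mul_dvd ?_ (h 0) (h 1)) (h 2)
  · exact (rel_sv_sv 0 2 (by decide)).mul_left (rel_sv_sv 1 2 (by decide))
  · exact rel_sv_sv 0 1 (by decide)

lemma surj {h : V2 → R3} (hh : h ∈ HTG2) : ∃ p, φG2 p = h := by
  -- fibre (0,+)
  obtain ⟨P1, hP1⟩ := step hh 1 0 true 1 (fun v _ => by simp) (fun v _ => one_dvd _)
    (fun b c _ _ _ => isRelPrime_one_right)
  have hh1 := sub_mem hh (phi_mem (1 * P1))
  set h1 := h - φG2 (1 * P1) with e1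
  -- fibre (1,+)
  obtain ⟨P2, hP2⟩ := step hh1 (X 0 - ss 0) 1 true (sv 1 - sv 0)
    (fun v hv => by simp [tauG, hv])
    (fun v hv => by rw [← hv]; exact edge_same hh1 (by rw [hv]; decide) hP1)
    (fun b c hbc hb hc => rel_D_D b c 1 0 hbc (by decide) (Or.inl ⟨hb.symm, hc.symm⟩))
  have hh2 := sub_mem hh1 (phi_mem ((X 0 - ss 0) * P2))
  have hP1 := van_sub P2 hP1 (g := X 0 - ss 0) (fun v hv => by simp [tauG, hv])
  set h2 := h1 - φG2 ((X 0 - ss 0) * P2) with e2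
  -- fibre (2,+)
  obtain ⟨P3, hP3⟩ := step hh2 ((X 0 - ss 0) * (X 0 - ss 1)) 2 true
    ((sv 2 - sv 0) * (sv 2 - sv 1))
    (fun v hv => by simp [tauG, hv])
    (fun v hv => by
      refine IsRelPrime.mul_dvd (rel_D_D 2 0 2 1 (by decide) (by decide) (by decide)) ?_ ?_
      · rw [← hv]; exact edge_same hh2 (by rw [hv]; decide) hP1
      · rw [← hv]; exact edge_same hh2 (by rw [hv]; decide) hP2)
    (fun b c hbc hb hc =>
      (rel_D_D b c 2 0 hbc (by decide) (Or.inl ⟨hb.symm, hc.symm⟩)).mul_right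
        (rel_D_D b c 2 1 hbc (by decide) (Or.inl ⟨hb.symm, hc.symm⟩)))
  have hh3 := sub_mem hh2 (phi_mem ((X 0 - ss 0) * (X 0 - ss 1) * P3))
  have hP1 := van_sub P3 hP1 (g := (X 0 - ss 0) * (X 0 - ss 1))
    (fun v hv => by simp [tauG, hv])
  have hP2 := van_sub P3 hP2 (g := (X 0 - ss 0) * (X 0 - ss 1))
    (fun v hv => by simp [tauG, hv])
  set h3 := h2 - φG2 ((X 0 - ss 0) * (X 0 - ss 1) * P3) with e3
  have hT : ∀ a, Van h3 a true := by
    intro a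
    fin_cases a
    · exact hP1
    · exact hP2
    · exact hP3
  -- fibre (0,-)
  obtain ⟨P4, hP4⟩ := step hh3 (yemb sig - X 6) 0 false sig
    (fun v hv => by simp [fG])
    (fun v hv => sig_dvd (edge_opp hh3 v hT))
    (fun b c hbc _ _ => rel_D_sig b c hbc)
  have hh4 := sub_mem hh3 (phi_mem ((yemb sig - X 6) * P4))
  have hT := fun a => van_sub P4 (hT a) (g := yemb sig - X 6)
    (fun v hv => by simp [fG, sig])
  set h4 := h3 - φG2 ((yemb sig - X 6) * P4) with e4
  -- fibre (1,-)
  obtain ⟨P5, hP5⟩ := step hh4 ((yemb sig - X 6) * (X 0 + ss 0)) 1 false (sig * (sv 0 - sv 1))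
    (fun v hv => by simp [fG, tauG, hv]; exact Or.inl (by ring))
    (fun v hv => by
      refine IsRelPrime.mul_dvd (rel_D_sig 0 1 (by decide)).symm (sig_dvd (edge_opp hh4 v hT)) ?_
      rw [← hv]; exact edge_same' hh4 (by rw [hv]; decide) hP4)
    (fun b c hbc hb hc => (rel_D_sig b c hbc).mul_right
      (rel_D_D b c 0 1 hbc (by decide) (Or.inr ⟨hb.symm, hc.symm⟩)))
  have hh5 := sub_mem hh4 (phi_mem ((yemb sig - X 6) * (X 0 + ss 0) * P5))
  have hT := fun a => van_sub P5 (hT a) (g := (yemb sig - X 6) * (X 0 + ss 0))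
    (fun v hv => by simp [fG, sig])
  have hP4 := van_sub P5 hP4 (g := (yemb sig - X 6) * (X 0 + ss 0))
    (fun v hv => by simp [tauG, hv])
  set h5 := h4 - φG2 ((yemb sig - X 6) * (X 0 + ss 0) * P5) with e5
  -- fibre (2,-)
  obtain ⟨P6, hP6⟩ := step hh5 ((yemb sig - X 6) * ((X 0 + ss 0) * (X 0 + ss 1))) 2 false
    (sig * ((sv 0 - sv 2) * (sv 1 - sv 2)))
    (fun v hv => by simp [fG, tauG, hv]; exact Or.inl (by ring))
    (fun v hv => by
      refine IsRelPrime.mul_dvd ((rel_D_sig 0 2 (by decide)).symm.mul_right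
        (rel_D_sig 1 2 (by decide)).symm) (sig_dvd (edge_opp hh5 v hT)) ?_
      refine IsRelPrime.mul_dvd (rel_D_D 0 2 1 2 (by decide) (by decide) (by decide)) ?_ ?_
      · rw [← hv]; exact edge_same' hh5 (by rw [hv]; decide) hP4
      · rw [← hv]; exact edge_same' hh5 (by rw [hv]; decide) hP5)
    (fun b c hbc hb hc => (rel_D_sig b c hbc).mul_right
      ((rel_D_D b c 0 2 hbc (by decide) (Or.inr ⟨hb.symm, hc.symm⟩)).mul_right
        (rel_D_D b c 1 2 hbc (by decide) (Or.inr ⟨hb.symm, hc.symm⟩))))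
  have hT := fun a => van_sub P6 (hT a) (g := (yemb sig - X 6) * ((X 0 + ss 0) * (X 0 + ss 1)))
    (fun v hv => by simp [fG, sig])
  have hP4 := van_sub P6 hP4 (g := (yemb sig - X 6) * ((X 0 + ss 0) * (X 0 + ss 1)))
    (fun v hv => by simp [tauG, hv])
  have hP5 := van_sub P6 hP5 (g := (yemb sig - X 6) * ((X 0 + ss 0) * (X 0 + ss 1)))
    (fun v hv => by simp [tauG, hv])
  set h6 := h5 - φG2 ((yemb sig - X 6) * ((X 0 + ss 0) * (X 0 + ss 1)) * P6) with e6
  have hF : ∀ a, Van h6 a false := by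
    intro a
    fin_cases a
    · exact hP4
    · exact hP5
    · exact hP6
  have h0 : h6 = 0 := by
    funext ⟨v, ε⟩
    cases ε
    · exact hF _ v rfl
    · exact hT _ v rfl
  refine ⟨1 * P1 + (X 0 - ss 0) * P2 + (X 0 - ss 0) * (X 0 - ss 1) * P3 + (yemb sig - X 6) * P4
    + (yemb sig - X 6) * (X 0 + ss 0) * P5
    + (yemb sig - X 6) * ((X 0 + ss 0) * (X 0 + ss 1)) * P6, ?_⟩
  simp only [map_add φG2]
  rw [e6, e5, e4, e3, e2, e1] at h0
  rw [← sub_eq_zero, ← neg_eq_zero, ← h0]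
  abel

/-! ### The kernel -/

lemma Ig2_le : Ig2 ≤ RingHom.ker φG2 := by
  rw [Ig2, Ideal.span_le]
  have hs := sum_sv
  have hw : ∀ v : Perm (Fin 3), sv (v 0) + sv (v 1) + sv (v 2) = sv 0 + sv 1 + sv 2 ∧
      sv (v 0) * sv (v 1) + sv (v 0) * sv (v 2) + sv (v 1) * sv (v 2) =
        sv 0 * sv 1 + sv 0 * sv 2 + sv 1 * sv 2 ∧
      sv (v 0) * sv (v 1) * sv (v 2) = sv 0 * sv 1 * sv 2 := by
    intro v
    have h1 : v 0 ≠ v 1 := by simp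
    have h2 : v 0 ≠ v 2 := by simp
    have h3 : v 1 ≠ v 2 := by simp
    generalize v 0 = a at *
    generalize v 1 = b at *
    generalize v 2 = c at *
    fin_cases a <;> fin_cases b <;> fin_cases c <;> simp at h1 h2 h3 ⊢ <;>
      refine ⟨?_, ?_, ?_⟩ <;> first | ring1 | exact Or.inl (by ring1)
  have e0 : (X 0 - X 1 : R3) = sv 0 := by simp [sv]
  have e1 : (X 1 - X 2 : R3) = sv 1 := by simp [sv]
  have e2 : (X 2 - X 0 : R3) = sv 2 := by simp [sv]
  have e3 : ∀ w, φG2 2 w = 2 := fun w => by rw [map_ofNat φG2 2]; rfl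
  rintro p (rfl | rfl | rfl | rfl) <;> rw [SetLike.mem_coe, RingHom.mem_ker] <;>
    funext ⟨v, ε⟩ <;> obtain ⟨hv1, hv2, hv3⟩ := hw v <;> cases ε <;>
    simp [s1p, s2p, s3p, tauG, fG, e0, e1, e2, e3]
  · linear_combination - hv1 - hs
  · linear_combination hv1 + hs
  · linear_combination hv2
  · linear_combination hv2
  · linear_combination hv3
  · linear_combination - hv3
  · ring

/-- The module spanned by `1, x, x², z, xz, x²z`. -/
noncomputable def Nf (m : Fin 6 → R3) : MvPolynomial (Fin 7) ℤ :=
  yemb (m 0) + yemb (m 1) * X 0 + yemb (m 2) * X 0 ^ 2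
    + X 6 * (yemb (m 3) + yemb (m 4) * X 0 + yemb (m 5) * X 0 ^ 2)

noncomputable def qq : MvPolynomial (Fin 7) ℤ →+* MvPolynomial (Fin 7) ℤ ⧸ Ig2 :=
  Ideal.Quotient.mk Ig2

noncomputable def e2s : R3 := sv 0 * sv 1 + sv 0 * sv 2 + sv 1 * sv 2

lemma q1 : qq (X 0) + qq (X 1) + qq (X 2) = 0 := by
  rw [← map_add, ← map_add, qq, Ideal.Quotient.eq_zero_iff_mem]
  exact Ideal.subset_span (by simp)

lemma yemb_sv0 : yemb (sv 0) = s1p := by simp [sv, s1p]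
lemma yemb_sv1 : yemb (sv 1) = s2p := by simp [sv, s2p]
lemma yemb_sv2 : yemb (sv 2) = s3p := by simp [sv, s3p]

lemma q2 : qq (X 0) * qq (X 1) + qq (X 0) * qq (X 2) + qq (X 1) * qq (X 2)
    = qq (yemb e2s) := by
  rw [← sub_eq_zero]
  simp only [← map_mul, ← map_add, ← map_sub]
  rw [qq, Ideal.Quotient.eq_zero_iff_mem]
  refine Ideal.subset_span ?_
  simp [e2s, yemb_sv0, yemb_sv1, yemb_sv2]

lemma q3 : 2 * qq (X 6) - qq (X 0) * qq (X 1) * qq (X 2) - qq (yemb sig) = 0 := by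
  have : (2 : MvPolynomial (Fin 7) ℤ ⧸ Ig2) = qq 2 := (map_ofNat qq 2).symm
  rw [this]
  simp only [← map_mul, ← map_sub]
  rw [qq, Ideal.Quotient.eq_zero_iff_mem]
  refine Ideal.subset_span ?_
  simp [sig, yemb_sv0, yemb_sv1, yemb_sv2]

lemma q4 : qq (X 6) ^ 2 - qq (X 6) * qq (yemb sig) = 0 := by
  simp only [← map_mul, ← map_sub, ← map_pow]
  rw [qq, Ideal.Quotient.eq_zero_iff_mem]
  refine Ideal.subset_span ?_
  simp [sig, yemb_sv0, yemb_sv1, yemb_sv2]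

lemma q_sq : qq (X 1) ^ 2 = - qq (yemb e2s) - qq (X 0) ^ 2 - qq (X 0) * qq (X 1) := by
  linear_combination (qq (X 0) + qq (X 1)) * q1 - q2

lemma q_cube : qq (X 0) ^ 3 = - qq (yemb e2s) * qq (X 0) + 2 * qq (X 6) - qq (yemb sig) := by
  linear_combination (qq (X 0) ^ 2) * q1 - qq (X 0) * q2 - q3

/-- The image of the span of `1, x, x², z, xz, x²z` in the quotient. -/
def NN (a : MvPolynomial (Fin 7) ℤ ⧸ Ig2) : Prop := ∃ m, a = qq (Nf m)

lemma NN_add {a b} (ha : NN a) (hb : NN b) : NN (a + b) := by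
  obtain ⟨m, rfl⟩ := ha
  obtain ⟨n, rfl⟩ := hb
  refine ⟨m + n, ?_⟩
  rw [← map_add]
  congr 1
  simp only [Nf, Pi.add_apply, map_add]
  ring

lemma NN_y {a} (ha : NN a) (r : R3) : NN (a * qq (yemb r)) := by
  obtain ⟨m, rfl⟩ := ha
  refine ⟨fun i => m i * r, ?_⟩
  rw [← map_mul]
  congr 1
  simp only [Nf, map_mul]
  ring

lemma NN_neg {a} (ha : NN a) : NN (-a) := by
  have := NN_y ha (-1)
  rw [map_neg, map_one, map_neg, map_one] at this
  convert this using 1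
  ring

lemma NN_x {a} (ha : NN a) : NN (a * qq (X 0)) := by
  obtain ⟨m, rfl⟩ := ha
  refine ⟨![- m 2 * sig, m 0 - m 2 * e2s, m 1, 2 * m 2 + m 5 * sig, m 3 - m 5 * e2s, m 4], ?_⟩
  have e : qq (yemb 2) = 2 := by rw [map_ofNat yemb 2, map_ofNat qq 2]
  simp [Nf, e]
  linear_combination (qq (yemb (m 2)) + qq (X 6) * qq (yemb (m 5))) * q_cube
    + 2 * qq (yemb (m 5)) * q4

lemma NN_z {a} (ha : NN a) : NN (a * qq (X 6)) := by
  obtain ⟨m, rfl⟩ := ha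
  refine ⟨![0, 0, 0, m 0 + m 3 * sig, m 1 + m 4 * sig, m 2 + m 5 * sig], ?_⟩
  simp [Nf]
  linear_combination (qq (yemb (m 3)) + qq (yemb (m 4)) * qq (X 0)
    + qq (yemb (m 5)) * qq (X 0) ^ 2) * q4

/-- The image of the span of all twelve monomials in the quotient. -/
def MM (a : MvPolynomial (Fin 7) ℤ ⧸ Ig2) : Prop := ∃ b c, NN b ∧ NN c ∧ a = b + c * qq (X 1)

lemma MM_add {a b} (ha : MM a) (hb : MM b) : MM (a + b) := by
  obtain ⟨c, d, hc, hd, rfl⟩ := ha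
  obtain ⟨c', d', hc', hd', rfl⟩ := hb
  exact ⟨_, _, NN_add hc hc', NN_add hd hd', by ring⟩

lemma MM_neg {a} (ha : MM a) : MM (-a) := by
  obtain ⟨c, d, hc, hd, rfl⟩ := ha
  exact ⟨_, _, NN_neg hc, NN_neg hd, by ring⟩

lemma MM_y {a} (ha : MM a) (r : R3) : MM (a * qq (yemb r)) := by
  obtain ⟨c, d, hc, hd, rfl⟩ := ha
  exact ⟨_, _, NN_y hc r, NN_y hd r, by ring⟩

lemma MM_x {a} (ha : MM a) : MM (a * qq (X 0)) := by
  obtain ⟨c, d, hc, hd, rfl⟩ := ha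
  exact ⟨_, _, NN_x hc, NN_x hd, by ring⟩

lemma MM_z {a} (ha : MM a) : MM (a * qq (X 6)) := by
  obtain ⟨c, d, hc, hd, rfl⟩ := ha
  exact ⟨_, _, NN_z hc, NN_z hd, by ring⟩

lemma MM_x1 {a} (ha : MM a) : MM (a * qq (X 1)) := by
  obtain ⟨c, d, hc, hd, rfl⟩ := ha
  refine ⟨_, _, NN_neg (NN_add (NN_y hd e2s) (NN_x (NN_x hd))), NN_add hc (NN_neg (NN_x hd)), ?_⟩
  linear_combination d * q_sq

lemma MM_x2 {a} (ha : MM a) : MM (a * qq (X 2)) := by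
  have h := MM_neg (MM_add (MM_x ha) (MM_x1 ha))
  convert h using 1
  linear_combination a * q1

lemma MM_all (p : MvPolynomial (Fin 7) ℤ) : MM (qq p) := by
  induction p using MvPolynomial.induction_on with
  | C a =>
    refine ⟨_, _, ⟨![(a : R3), 0, 0, 0, 0, 0], rfl⟩, ⟨0, rfl⟩, ?_⟩
    simp [Nf]
  | add p q hp hq => rw [map_add]; exact MM_add hp hq
  | mul_X p i hp =>
    rw [map_mul]
    fin_cases i
    · exact MM_x hp
    · exact MM_x1 hp
    · exact MM_x2 hp
    · have := MM_y hp (X 0); rwa [yemb_X0] at this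
    · have := MM_y hp (X 1); rwa [yemb_X1] at this
    · have := MM_y hp (X 2); rwa [yemb_X2] at this
    · exact MM_z hp

lemma sv_inj {a b : Fin 3} (h : a ≠ b) : sv a - sv b ≠ 0 := (prime_D a b h).ne_zero

lemma quad_zero (x y z c0 c1 c2 : R3) (hxy : x - y ≠ 0) (hxz : x - z ≠ 0) (hyz : y - z ≠ 0)
    (h1 : c0 + c1 * x + c2 * x ^ 2 = 0) (h2 : c0 + c1 * y + c2 * y ^ 2 = 0)
    (h3 : c0 + c1 * z + c2 * z ^ 2 = 0) : c0 = 0 ∧ c1 = 0 ∧ c2 = 0 := by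
  have e1 : c1 + c2 * (x + y) = 0 :=
    (mul_eq_zero.mp (show (x - y) * (c1 + c2 * (x + y)) = 0 by
      linear_combination h1 - h2)).resolve_left hxy
  have e2 : c1 + c2 * (x + z) = 0 :=
    (mul_eq_zero.mp (show (x - z) * (c1 + c2 * (x + z)) = 0 by
      linear_combination h1 - h3)).resolve_left hxz
  have e3 : c2 = 0 :=
    (mul_eq_zero.mp (show (y - z) * c2 = 0 by linear_combination e1 - e2)).resolve_left hyz
  subst e3
  have e4 : c1 = 0 := by linear_combination e1
  subst e4
  exact ⟨by linear_combination h1, rfl, rfl⟩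

/-- The value of `Nf m` at the fibre `(a, ε)`. -/
noncomputable def nv (m : Fin 6 → R3) (a : Fin 3) (ε : Bool) : R3 :=
  if ε then (m 0 + sig * m 3) + (m 1 + sig * m 4) * sv a + (m 2 + sig * m 5) * sv a ^ 2
  else m 0 + m 1 * (- sv a) + m 2 * (- sv a) ^ 2

lemma phi_Nf (m : Fin 6 → R3) (v : Perm (Fin 3)) (ε : Bool) :
    φG2 (Nf m) (v, ε) = nv m (v 0) ε := by
  cases ε
  · simp [Nf, nv, fG, tauG]
  · simp [Nf, nv, fG, tauG, sig]
    ring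

lemma sig_ne : sig ≠ 0 :=
  mul_ne_zero (mul_ne_zero (prime_sv 0).ne_zero (prime_sv 1).ne_zero) (prime_sv 2).ne_zero

lemma Nf_zero (m : Fin 6 → R3) (h : ∀ a ε, nv m a ε = 0) : Nf m = 0 := by
  have s01 := sv_inj (show (0 : Fin 3) ≠ 1 by decide)
  have s02 := sv_inj (show (0 : Fin 3) ≠ 2 by decide)
  have s12 := sv_inj (show (1 : Fin 3) ≠ 2 by decide)
  have hn : ∀ {x y : R3}, x - y ≠ 0 → -x - -y ≠ 0 := by
    intro x y hxy h0
    exact hxy (by linear_combination - h0)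
  obtain ⟨a0, a1, a2⟩ := quad_zero _ _ _ _ _ _ (hn s01) (hn s02) (hn s12)
    (by simpa [nv] using h 0 false) (by simpa [nv] using h 1 false)
    (by simpa [nv] using h 2 false)
  obtain ⟨a3, a4, a5⟩ := quad_zero _ _ _ _ _ _ s01 s02 s12
    (h 0 true) (h 1 true) (h 2 true)
  rw [a0, zero_add] at a3
  rw [a1, zero_add] at a4
  rw [a2, zero_add] at a5
  have b3 := (mul_eq_zero.mp a3).resolve_left sig_ne
  have b4 := (mul_eq_zero.mp a4).resolve_left sig_ne
  have b5 := (mul_eq_zero.mp a5).resolve_left sig_ne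
  simp [Nf, a0, a1, a2, b3, b4, b5]

lemma fibre_zero (m n : Fin 6 → R3) (h : φG2 (Nf m + Nf n * X 1) = 0) (a : Fin 3) (ε : Bool) :
    nv m a ε = 0 ∧ nv n a ε = 0 := by
  obtain ⟨v, hv⟩ : ∃ v : Perm (Fin 3), v 0 = a := ⟨swap 0 a, by simp⟩
  have hv' : (v * swap 1 2 : Perm (Fin 3)) 0 = a := by
    rw [Perm.mul_apply, swap_apply_of_ne_of_ne (by decide) (by decide), hv]
  have h1 := congrFun h (v, ε)
  have h2 := congrFun h (v * swap 1 2, ε)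
  rw [map_add, map_mul, Pi.add_apply, Pi.mul_apply, phi_Nf, phi_Nf, phi_X1, Pi.zero_apply] at h1 h2
  rw [hv] at h1
  rw [hv'] at h2
  have hne : sv (v 1) - sv (v 2) ≠ 0 := sv_inj (by simp)
  have h0 : nv n a ε = 0 := by
    cases ε <;> simp [tauG] at h1 h2
    · exact (mul_eq_zero.mp (show (sv (v 1) - sv (v 2)) * nv n a false = 0 by
        linear_combination h2 - h1)).resolve_left hne
    · exact (mul_eq_zero.mp (show (sv (v 1) - sv (v 2)) * nv n a true = 0 by
        linear_combination h1 - h2)).resolve_left hne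
  rw [h0, zero_mul, add_zero] at h1
  exact ⟨h1, h0⟩

lemma ker_le : RingHom.ker φG2 ≤ Ig2 := by
  intro p hp
  rw [RingHom.mem_ker] at hp
  obtain ⟨b, c, ⟨m, rfl⟩, ⟨n, rfl⟩, hq⟩ := MM_all p
  rw [← map_mul, ← map_add] at hq
  have hmem : p - (Nf m + Nf n * X 1) ∈ Ig2 := (Ideal.Quotient.eq).mp hq
  have h0 := Ig2_le hmem
  rw [RingHom.mem_ker, map_sub, hp, zero_sub, neg_eq_zero] at h0
  have hm := Nf_zero m (fun a ε => (fibre_zero m n h0 a ε).1)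
  have hn := Nf_zero n (fun a ε => (fibre_zero m n h0 a ε).2)
  simpa [hm, hn] using hmem

theorem image_eq_HTG2_and_ker_eq_I :
    Set.range ⇑φG2 = (HTG2 : Set (V2 → R3)) ∧ RingHom.ker φG2 = Ig2 ∧
      Nonempty ((MvPolynomial (Fin 7) ℤ ⧸ Ig2) ≃+* HTG2) := by
  have hr : Set.range ⇑φG2 = (HTG2 : Set (V2 → R3)) := by
    ext h
    constructor
    · rintro ⟨p, rfl⟩
      exact phi_mem p
    · exact fun hh => surj hh
  have hk : RingHom.ker φG2 = Ig2 := le_antisymm ker_le Ig2_le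
  refine ⟨hr, hk, ⟨?_⟩⟩
  have hrange : φG2.range = HTG2 := SetLike.coe_injective (by rw [RingHom.coe_range]; exact hr)
  exact ((Ideal.quotEquivOfEq hk.symm).trans (RingHom.quotientKerEquivRange φG2)).trans
    (RingEquiv.subringCongr hrange)
end

section
/- For each i = 1,2,3, the element τᵢ belongs to H*_T(𝒢₂); that is, for every edge of the labeled graph 𝒢₂ with endpoints w₁, w₂ and label ℓ, the difference τᵢ(w₁) − τᵢ(w₂) is divisible by ℓ in R. -/
open MvPolynomial Equiv

/-- The three weights at distinct indices sum to zero. -/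
lemma sv_sum_zero (a b c : Fin 3) (hab : a ≠ b) (hac : c ≠ a) (hbc : c ≠ b) :
    sv a + sv b + sv c = 0 := by
  have h : sv 0 + sv 1 + sv 2 = 0 := by
    have h2 : (2 : Fin 3) + 1 = 0 := rfl
    have h1 : (1 : Fin 3) + 1 = 2 := rfl
    simp only [sv, h1, h2, zero_add]
    ring
  fin_cases a <;> fin_cases b <;> fin_cases c <;> simp_all <;> linear_combination h

/-- For each `i`, the element `τᵢ` belongs to the graph cohomology ring `H*_T(𝒢₂)`. -/
theorem tauG_mem_graph_cohomology : ∀ i : Fin 3, gkm (tauG i) := by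
  intro m v₁ v₂ ε₁ ε₂ i j hij hv
  have hv2 : ∀ x, v₂ x = v₁ (Equiv.swap i j x) := by
    intro x
    simp [hv]
  have hm : m = i ∨ m = j ∨ (m ≠ i ∧ m ≠ j) := by tauto
  constructor
  · rintro rfl
    rcases hm with rfl | rfl | ⟨h1, h2⟩
    · cases ε₁ <;> simp only [tauG, hv2, Equiv.swap_apply_left]
      · exact ⟨-1, by simp; ring⟩
      · exact ⟨1, by simp⟩
    · cases ε₁ <;> simp only [tauG, hv2, Equiv.swap_apply_right]
      · exact ⟨1, by simp; ring⟩
      · exact ⟨-1, by simp⟩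
    · simp [tauG, hv2, Equiv.swap_apply_of_ne_of_ne h1 h2]
  · intro hε k hki hkj
    have hs := sv_sum_zero (v₁ i) (v₁ j) (v₁ k) (v₁.injective.ne hij)
      (v₁.injective.ne hki) (v₁.injective.ne hkj)
    have key : sv (v₁ k) ∣ sv (v₁ m) + sv (v₂ m) := by
      rcases hm with rfl | rfl | ⟨h1, h2⟩
      · rw [hv2, Equiv.swap_apply_left]
        exact ⟨-1, by linear_combination hs⟩
      · rw [hv2, Equiv.swap_apply_right]
        exact ⟨-1, by linear_combination hs⟩
      · have hmk : m = k := by omega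
        subst hmk
        rw [hv2, Equiv.swap_apply_of_ne_of_ne h1 h2]
        exact ⟨2, by ring⟩
    obtain ⟨c, hc⟩ := key
    cases ε₁ <;> cases ε₂ <;> simp only [tauG] <;> simp at hε ⊢
    · exact ⟨-c, by linear_combination -hc⟩
    · exact ⟨c, hc⟩
end

section
/- For every h ∈ H*_T(𝒢₂) such that h(w) is homogeneous of a fixed degree k (or zero) for all w ∈ V, there exists a polynomial G in the elements τ₁, τ₂, τ₃, t₁, t₂, t₃ (i.e., an element of the subring of ∏_{w ∈ V} R generated by τ₁, τ₂, τ₃, t₁, t₂, t₃) such that h(v,−) = G(v,−) for every v ∈ S₃. -/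
open MvPolynomial Equiv

lemma const_mem_closure (c : R3) :
    (fun _ : V2 => c) ∈ Subring.closure {tauG 0, tauG 1, tauG 2, tG 0, tG 1, tG 2} := by
  induction c using MvPolynomial.induction_on with
  | C a =>
    have : (fun _ : V2 => (C a : R3)) = ((a : ℤ) : V2 → R3) := by
      funext w; simp
    rw [this]; exact intCast_mem _ a
  | add p q hp hq => exact add_mem hp hq
  | mul_X p i hp =>
    refine mul_mem hp (Subring.subset_closure ?_)
    change tG i ∈ _
    fin_cases i <;> simp

/-- Substituting `c` for the variable `X 0`. -/
noncomputable def subst0 (c : R3) : R3 →ₐ[ℤ] R3 := aeval ![c, X 1, X 2]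

lemma dvd_sub_subst0 (c g : R3) : X 0 - c ∣ g - subst0 c g := by
  induction g using MvPolynomial.induction_on with
  | C a => simp [subst0]
  | add p q hp hq =>
    rw [map_add, add_sub_add_comm]; exact dvd_add hp hq
  | mul_X p i hp =>
    have hX : X 0 - c ∣ (X i : R3) - subst0 c (X i) := by
      fin_cases i <;> simp [subst0]
    obtain ⟨u, hu⟩ := hp
    obtain ⟨w, hw⟩ := hX
    refine ⟨u * X i + subst0 c p * w, ?_⟩
    rw [map_mul]
    linear_combination (X i) * hu + subst0 c p * hw

lemma dvd_of_dvd_mul_subst0 (c a u : R3) (hc : subst0 c c = c) (ha : subst0 c a ≠ 0)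
    (h : X 0 - c ∣ a * u) : X 0 - c ∣ u := by
  obtain ⟨w, hw⟩ := h
  have h0 : subst0 c (X 0 - c) = 0 := by
    rw [map_sub, hc]; simp [subst0]
  have h1 := congrArg (subst0 c) hw
  rw [map_mul, map_mul, h0, zero_mul] at h1
  have h2 : subst0 c u = 0 := (mul_eq_zero.mp h1).resolve_left ha
  have h3 := dvd_sub_subst0 c u
  rwa [h2, sub_zero] at h3

lemma three_ne : (3 * X 2 - 3 * X 1 : R3) ≠ 0 := by
  intro h
  have := congrArg (eval ![0, 0, 1]) h
  simp at this

lemma cancel_B_A (u : R3) (h : sv 2 - sv 1 ∣ (sv 2 - sv 0) * u) : sv 2 - sv 1 ∣ u := by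
  have e : (sv 2 - sv 1 : R3) = -(X 0 - (2 * X 2 - X 1)) := by
    simp [sv]; ring
  rw [e, neg_dvd] at h ⊢
  refine dvd_of_dvd_mul_subst0 _ _ _ (by simp [subst0, map_ofNat]) ?_ h
  intro h0
  apply three_ne
  simp [sv, subst0] at h0
  linear_combination -h0

lemma cancel_C_A (u : R3) (h : sv 1 - sv 0 ∣ (sv 2 - sv 0) * u) : sv 1 - sv 0 ∣ u := by
  have e : (sv 1 - sv 0 : R3) = -(X 0 - (2 * X 1 - X 2)) := by
    simp [sv]; ring
  rw [e, neg_dvd] at h ⊢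
  refine dvd_of_dvd_mul_subst0 _ _ _ (by simp [subst0, map_ofNat]) ?_ h
  intro h0
  apply three_ne
  simp [sv, subst0] at h0
  linear_combination h0

lemma cancel_C_B (u : R3) (h : sv 1 - sv 0 ∣ (sv 2 - sv 1) * u) : sv 1 - sv 0 ∣ u := by
  have e : (sv 1 - sv 0 : R3) = -(X 0 - (2 * X 1 - X 2)) := by
    simp [sv]; ring
  rw [e, neg_dvd] at h ⊢
  refine dvd_of_dvd_mul_subst0 _ _ _ (by simp [subst0, map_ofNat]) ?_ h
  intro h0
  apply three_ne
  simp [sv, subst0] at h0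
  linear_combination h0

/-- Newton interpolation for the six values. -/
lemma newton (f1 f2 f3 f4 f5 f6 : R3)
    (h12 : sv 1 - sv 0 ∣ f2 - f1) (h13 : sv 2 - sv 1 ∣ f3 - f1)
    (h34 : sv 2 - sv 0 ∣ f4 - f3) (h24 : sv 2 - sv 1 ∣ f4 - f2)
    (h35 : sv 1 - sv 0 ∣ f5 - f3) (h25 : sv 2 - sv 0 ∣ f5 - f2)
    (h16 : sv 2 - sv 0 ∣ f6 - f1) (h46 : sv 1 - sv 0 ∣ f6 - f4)
    (h56 : sv 2 - sv 1 ∣ f6 - f5) :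
    ∃ c1 c2 c3 c4 c5 c6 : R3, ∀ P : R3 → R3 → R3 → R3,
      (∀ x0 x1 x2, P x0 x1 x2 = c1 + c2 * (x0 - sv 0) + c3 * (x2 - sv 2)
        + c4 * ((x0 - sv 0) * (x0 - sv 1)) + c5 * ((x2 - sv 2) * (x2 - sv 1))
        + c6 * ((x0 - sv 0) * (x0 - sv 1) * (x1 - sv 0))) →
      f1 = P (sv 0) (sv 1) (sv 2) ∧ f2 = P (sv 1) (sv 0) (sv 2) ∧
      f3 = P (sv 0) (sv 2) (sv 1) ∧ f4 = P (sv 2) (sv 0) (sv 1) ∧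
      f5 = P (sv 1) (sv 2) (sv 0) ∧ f6 = P (sv 2) (sv 1) (sv 0) := by
  have cBA := cancel_B_A
  have cCA := cancel_C_A
  have cCB := cancel_C_B
  generalize sv 0 = y0 at *
  generalize sv 1 = y1 at *
  generalize sv 2 = y2 at *
  obtain ⟨a12, h12⟩ := h12
  obtain ⟨a13, h13⟩ := h13
  obtain ⟨a34, h34⟩ := h34
  obtain ⟨a24, h24⟩ := h24
  obtain ⟨a35, h35⟩ := h35
  obtain ⟨a25, h25⟩ := h25
  obtain ⟨a16, h16⟩ := h16
  obtain ⟨a46, h46⟩ := h46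
  obtain ⟨a56, h56⟩ := h56
  -- c1 = f1, c2 = a12, c3 = -a13
  obtain ⟨c4, h4⟩ := cBA (a34 - a12) ⟨a24 - a12 - a13, by
    linear_combination (-1 : R3) * h34 + h24 + h12 - h13⟩
  obtain ⟨c5, h5⟩ := cCA (a25 - a13) ⟨a35 - a13 - a12, by
    linear_combination (-1 : R3) * h25 + h35 + h13 - h12⟩
  -- residual at the last vertex, divided by `y2 - y0`
  obtain ⟨d, hd⟩ := cBA (a16 - a12 - a13 - (y2 - y1) * c4 - (y1 - y0) * c5)
    ⟨a56 - a12 - (y2 - y0) * c4 , by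
      linear_combination (-1 : R3) * h16 + h56 + h25 + h12 + (y2 - y0) * h5⟩
  obtain ⟨c6, h6⟩ := cCB d (cCA _ ⟨a46 - a13 - (y2 - y0) * c5, by
      linear_combination (-1 : R3) * (y2 - y0) * hd - h16 + h46 + h34 + h13 + (y2 - y0) * h4⟩)
  refine ⟨f1, a12, -a13, c4, c5, c6, fun P hP => ?_⟩
  simp only [hP]
  refine ⟨?_, ?_, ?_, ?_, ?_, ?_⟩
  · ring
  · linear_combination h12
  · linear_combination h13
  · linear_combination h34 + h13 + (y2 - y0) * h4
  · linear_combination h25 + h12 + (y2 - y0) * h5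
  · linear_combination h16 + (y2 - y0) * hd + (y2 - y0) * (y2 - y1) * h6

lemma perm_cases : ∀ v : Perm (Fin 3), v = 1 ∨ v = swap 0 1 ∨ v = swap 1 2 ∨
    v = swap 1 2 * swap 0 1 ∨ v = swap 0 1 * swap 1 2 ∨ v = swap 0 2 := by
  decide

/-- For every homogeneous `h ∈ H*_T(𝒢₂)` there is a polynomial `G` in
`τ₁, τ₂, τ₃, t₁, t₂, t₃` whose restriction to the subgraph `𝒢₋` coincides with
that of `h`. -/
theorem exists_poly_agreeing_on_minus_part (h : V2 → R3) (hh : gkm h) (k : ℕ)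
    (hom : ∀ w : V2, (h w).IsHomogeneous k) :
    ∃ G ∈ Subring.closure {tauG 0, tauG 1, tauG 2, tG 0, tG 1, tG 2},
      ∀ v : Perm (Fin 3), h (v, false) = G (v, false) := by
  have key : ∀ (v₁ v₂ : Perm (Fin 3)) (i j a b : Fin 3), i ≠ j → v₁ = v₂ * swap i j →
      v₁ i = a → v₁ j = b → sv a - sv b ∣ h (v₁, false) - h (v₂, false) := by
    intro v₁ v₂ i j a b hij hv ha hb
    subst ha hb
    exact (hh v₁ v₂ false false i j hij hv).1 rfl
  obtain ⟨c1, c2, c3, c4, c5, c6, hP⟩ := newton (h (1, false)) (h (swap 0 1, false))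
    (h (swap 1 2, false)) (h (swap 1 2 * swap 0 1, false)) (h (swap 0 1 * swap 1 2, false))
    (h (swap 0 2, false))
    (key _ _ 0 1 1 0 (by decide) (by decide) (by decide) (by decide))
    (key _ _ 1 2 2 1 (by decide) (by decide) (by decide) (by decide))
    (key _ _ 0 1 2 0 (by decide) (by decide) (by decide) (by decide))
    (key _ _ 0 2 2 1 (by decide) (by decide) (by decide) (by decide))
    (key _ _ 0 2 1 0 (by decide) (by decide) (by decide) (by decide))
    (key _ _ 1 2 2 0 (by decide) (by decide) (by decide) (by decide))
    (key _ _ 0 2 2 0 (by decide) (by decide) (by decide) (by decide))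
    (key _ _ 1 2 1 0 (by decide) (by decide) (by decide) (by decide))
    (key _ _ 0 1 2 1 (by decide) (by decide) (by decide) (by decide))
  have hP := hP _ (fun _ _ _ => rfl)
  have hx : ∀ i, -tauG i ∈ Subring.closure {tauG 0, tauG 1, tauG 2, tG 0, tG 1, tG 2} := by
    intro i
    refine neg_mem (Subring.subset_closure ?_)
    fin_cases i <;> simp
  have hc := const_mem_closure
  refine ⟨(fun _ => c1) + (fun _ => c2) * (-tauG 0 - fun _ => sv 0)
    + (fun _ => c3) * (-tauG 2 - fun _ => sv 2)
    + (fun _ => c4) * ((-tauG 0 - fun _ => sv 0) * (-tauG 0 - fun _ => sv 1))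
    + (fun _ => c5) * ((-tauG 2 - fun _ => sv 2) * (-tauG 2 - fun _ => sv 1))
    + (fun _ => c6) * ((-tauG 0 - fun _ => sv 0) * (-tauG 0 - fun _ => sv 1)
      * (-tauG 1 - fun _ => sv 0)), ?_, ?_⟩
  · have hd : ∀ i j, (-tauG i - fun _ => sv j) ∈
        Subring.closure {tauG 0, tauG 1, tauG 2, tG 0, tG 1, tG 2} :=
      fun i j => sub_mem (hx i) (hc _)
    exact add_mem (add_mem (add_mem (add_mem (add_mem (hc _) (mul_mem (hc _) (hd _ _)))
      (mul_mem (hc _) (hd _ _))) (mul_mem (hc _) (mul_mem (hd _ _) (hd _ _))))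
      (mul_mem (hc _) (mul_mem (hd _ _) (hd _ _))))
      (mul_mem (hc _) (mul_mem (mul_mem (hd _ _) (hd _ _)) (hd _ _)))
  · obtain ⟨p1, p2, p3, p4, p5, p6⟩ := hP
    have ev : ∀ (v : Perm (Fin 3)) (i a : Fin 3), v i = a → (-tauG i) (v, false) = sv a := by
      intro v i a hv
      subst hv
      simp [tauG]
    intro v
    simp only [Pi.add_apply, Pi.mul_apply, Pi.sub_apply]
    rcases perm_cases v with rfl | rfl | rfl | rfl | rfl | rfl
    · rw [ev _ 0 0 (by decide), ev _ 1 1 (by decide), ev _ 2 2 (by decide)]; exact p1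
    · rw [ev _ 0 1 (by decide), ev _ 1 0 (by decide), ev _ 2 2 (by decide)]; exact p2
    · rw [ev _ 0 0 (by decide), ev _ 1 2 (by decide), ev _ 2 1 (by decide)]; exact p3
    · rw [ev _ 0 2 (by decide), ev _ 1 0 (by decide), ev _ 2 1 (by decide)]; exact p4
    · rw [ev _ 0 1 (by decide), ev _ 1 2 (by decide), ev _ 2 0 (by decide)]; exact p5
    · rw [ev _ 0 2 (by decide), ev _ 1 1 (by decide), ev _ 2 0 (by decide)]; exact p6
end
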